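/- Let R be a commutative ring, x, y ∈ R, and n a positive integer. For every integer k ≥ 2, the n×n determinant det_{0≤i,j≤n−1}(P_{i+j+1}(0,k)) equals: (−1)^{k(n₁−1)−1}·(xy)^{kn₁(2kn₁−k−3)+k}·P_{n−k+2,k}(x,y) if n = 2kn₁−1 for a positive integer n₁; (−1)^{kn₁+C(k,2)}·(xy)^{k(n₁−1)(2kn₁−k+1)}·P_{n,k}(x,y) if n = 2kn₁−k+1; (−1)^{kn₁+C(k+1,2)}·(xy)^{k(n₁−1)(2kn₁−k−1)}·P_{n−k,k}(x,y) if n = 2kn₁−k; (−1)^{kn₁}·(xy)^{kn₁(2kn₁−k−1)}·P_{n,k}(x,y) if n = 2kn₁; and 0 if n is congruent to none of 0, k, k+1, 2k−1 modulo 2k. For k = 1, det_{0≤i,j≤n−1}(P_{i+j+1}(0,1)) = (−1)^{n₁}·(xy)^{2n₁(n₁−1)}·Σ_{s=0}^{n}(−1)^s x^s y^{n−s} if n = 2n₁, and = (−1)^{n₁+1}·(xy)^{2(n₁−1)²}·Σ_{s=0}^{n−1}(−1)^s x^s y^{n−1−s} if n = 2n₁−1. For k = 0, det_{0≤i,j≤n−1}(P_{i+j+1}(0,0))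 = 2^{n−1}·(xy)^{C(n,2)}·(x^n+y^n). -/

import Mathlib

/-- `pgf x y n k` is the generating function `P_n(0,k)` of lattice paths from `(0,0)` to
`(n,k)` with steps `(1,1)`, `(1,0)`, `(1,-1)`, weighted `1`, `x+y`, `xy` respectively:
`P_n(0,k) = Σ_ℓ C(n,ℓ)·C(n,n−k−ℓ)·x^ℓ·y^{n−k−ℓ}`, the sum over integers `ℓ ≥ 0` with
`n−k−ℓ ≥ 0` (terms with `ℓ > n` vanish since then `C(n,ℓ) = 0`). -/
def pgf {R : Type*} [CommRing R] (x y : R) (n : ℕ) (k : ℤ) : R :=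
  ∑ ℓ ∈ Finset.range (n + 1),
    if (ℓ : ℤ) ≤ (n : ℤ) - k then
      (n.choose ℓ : R) * (n.choose ((n : ℤ) - k - ℓ).toNat : R) *
        x ^ ℓ * y ^ ((n : ℤ) - k - ℓ).toNat
    else 0

/-- The polynomial `P_{m,k}(x,y)`:  `Σ_{s=0}^{m/k} (−1)^s x^{sk} y^{m−sk}` if `k ∣ m`, and
`Σ_{s=0}^{⌊m/k⌋} (−1)^s (x^{sk} y^{m−sk} + x^{m−sk} y^{sk})` otherwise. -/
def ppoly {R : Type*} [CommRing R] (x y : R) (m k : ℕ) : R :=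
  if k ∣ m then
    ∑ s ∈ Finset.range (m / k + 1), (-1 : R) ^ s * (x ^ (s * k) * y ^ (m - s * k))
  else
    ∑ s ∈ Finset.range (m / k + 1),
      (-1 : R) ^ s * (x ^ (s * k) * y ^ (m - s * k) + x ^ (m - s * k) * y ^ (s * k))

open Polynomial in
/-- Changing the monomials to another family of monic polynomials of the same degrees does not
change the determinant of a matrix of linear forms. -/
theorem det_linearMap_monic {K : Type*} [CommRing K] {m : ℕ} (φ : Fin m → K[X] →ₗ[K] K)
    (p : ℕ → K[X]) (hdeg : ∀ i, (p i).natDegree = i) (hmonic : ∀ i, (p i).Monic) :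
    Matrix.det (Matrix.of fun i j : Fin m => φ i (p j)) =
      Matrix.det (Matrix.of fun i j : Fin m => φ i (X ^ (j : ℕ))) := by
  have h : (Matrix.of fun i j : Fin m => φ i (p j)) =
      (Matrix.of fun i j : Fin m => φ i (X ^ (j : ℕ))) *
        Matrix.of fun i j : Fin m => (p j).coeff i := by
    ext i j
    have hp := (p j).as_sum_range' m (by rw [hdeg]; exact j.2)
    rw [Matrix.of_apply, Matrix.mul_apply]
    conv_lhs => rw [hp]
    rw [map_sum, Finset.sum_range]
    refine Finset.sum_congr rfl fun l _ => ?_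
    rw [Matrix.of_apply, Matrix.of_apply, ← C_mul_X_pow_eq_monomial, ← smul_eq_C_mul, map_smul,
      smul_eq_mul, mul_comm]
  rw [h, Matrix.det_mul, Matrix.det_matrixOfPolynomials (fun i : Fin m => p i)
    (fun i => hdeg i) (fun i => hmonic i), mul_one]

open Polynomial in
/-- A Hankel determinant of order one is, up to sign, a determinant bordered by the values at `0`
of the monic polynomials in use. -/
theorem det_hankel_succ_eq_bordered {K : Type*} [CommRing K] (n : ℕ) (φ : K[X] →ₗ[K] K)
    (p : ℕ → K[X]) (hdeg : ∀ i, (p i).natDegree = i) (hmonic : ∀ i, (p i).Monic) :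
    Matrix.det (Matrix.of fun i j : Fin n => φ (X ^ (i.1 + j.1 + 1))) =
      (-1) ^ n * Matrix.det (Matrix.of fun i j : Fin (n + 1) =>
        if i.1 < n then φ (p i * p j) else (p j).eval 0) := by
  let ψ : Fin (n + 1) → K[X] →ₗ[K] K := fun i =>
    if i.1 < n then φ ∘ₗ LinearMap.mulLeft K (p i) else leval 0
  have h₁ : (Matrix.of fun i j : Fin (n + 1) =>
      if i.1 < n then φ (p i * p j) else (p j).eval 0) =
      Matrix.of fun i j : Fin (n + 1) => ψ i (p j) := by
    ext i j
    simp only [Matrix.of_apply, ψ]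
    split_ifs <;> simp [leval]
  rw [h₁, det_linearMap_monic ψ p hdeg hmonic, Matrix.det_succ_row _ (Fin.last n),
    Fin.sum_univ_succ, Finset.sum_eq_zero, add_zero]
  · have h₂ : ((Matrix.of fun i j : Fin (n + 1) => ψ i (X ^ (j : ℕ))).submatrix
        (Fin.last n).succAbove (Fin.succAbove 0)).transpose =
        Matrix.of fun i j : Fin n => (φ ∘ₗ LinearMap.mulLeft K (X ^ (i.1 + 1))) (p j) := by
      ext i j
      simp [ψ, mul_comm]
    rw [← Matrix.det_transpose (Matrix.submatrix _ _ _), h₂,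
      det_linearMap_monic (fun i : Fin n => φ ∘ₗ LinearMap.mulLeft K (X ^ (i.1 + 1))) p hdeg
        hmonic]
    have h₃ : ((-1 : K) ^ n) * (-1) ^ n = 1 := by rw [← mul_pow]; simp
    simp only [Fin.val_last, Fin.val_zero, add_zero, Matrix.of_apply, ψ, lt_irrefl, if_false,
      pow_zero, leval_apply, eval_one, mul_one, ← mul_assoc, h₃, one_mul]
    congr 1
    ext i j
    simp only [Matrix.of_apply, LinearMap.comp_apply, LinearMap.mulLeft_apply, ← pow_add]
    congr 2
    ring
  · intro i _
    simp [ψ]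

open Polynomial in
/-- Dickson polynomials of the first kind of positive degree are monic. -/
theorem monic_dickson_one {K : Type*} [CommRing K] [Nontrivial K] (a : K) (n : ℕ) :
    (dickson 1 a (n + 1)).Monic ∧ (dickson 1 a (n + 1)).natDegree = n + 1 := by
  induction n using Nat.strong_induction_on with
  | _ n ih =>
    match n with
    | 0 => simp [monic_X]
    | n + 1 =>
      obtain ⟨hm, hd⟩ := ih n (by lia)
      have hx : (X * dickson 1 a (n + 1)).natDegree = n + 2 := by
        rw [natDegree_X_mul hm.ne_zero, hd]
      have hlow : (C a * dickson 1 a n).natDegree < (X * dickson 1 a (n + 1)).natDegree := by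
        refine lt_of_le_of_lt (natDegree_C_mul_le _ _) ?_
        rw [hx]
        match n with
        | 0 =>
          have h : (3 - (1 : ℕ) : K[X]) = C 2 := by
            rw [map_ofNat]
            norm_num
          rw [dickson_zero, h, natDegree_C]
          lia
        | n + 1 =>
          rw [(ih n (by lia)).2]
          lia
      rw [dickson_add_two]
      exact ⟨(monic_X.mul hm).sub_of_left (degree_lt_degree hlow),
        (natDegree_sub_eq_left_of_natDegree_lt hlow).trans hx⟩

open Polynomial in
/-- The monic polynomial of degree `j` in `z + a + z⁻¹` that equals `z ^ j + z ^ (-j)` if `0 < j`,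
and `1` if `j = 0`. -/
noncomputable def symPoly {K : Type*} [CommRing K] (a : K) (j : ℕ) : K[X] :=
  if j = 0 then 1 else (dickson 1 (1 : K) j).comp (X - C a)

open Polynomial in
theorem symPoly_monic {K : Type*} [CommRing K] [Nontrivial K] (a : K) (j : ℕ) :
    (symPoly a j).Monic := by
  unfold symPoly
  obtain _ | j := j
  · simp
  · rw [if_neg (by lia)]
    exact (monic_dickson_one 1 j).1.comp_X_sub_C a

open Polynomial in
theorem natDegree_symPoly {K : Type*} [CommRing K] [IsDomain K] (a : K) (j : ℕ) :
    (symPoly a j).natDegree = j := by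
  unfold symPoly
  obtain _ | j := j
  · simp
  · rw [if_neg (by lia), natDegree_comp, natDegree_X_sub_C, mul_one, (monic_dickson_one 1 j).2]

open Polynomial in
theorem aeval_symPoly {K A : Type*} [CommRing K] [CommRing A] [Algebra K A] (a : K) (u v t : A)
    (huv : u * v = 1) (ht : t - algebraMap K A a = u + v) (j : ℕ) :
    aeval t (symPoly a j) = if j = 0 then 1 else u ^ j + v ^ j := by
  unfold symPoly
  split_ifs with h
  · simp
  · rw [aeval_comp, map_sub, aeval_X, aeval_C, ht, aeval_def, ← eval_map, map_dickson, map_one,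
      dickson_one_one_eval_add_inv u v huv]

/-- The value of `symPoly (x + y) j` at `0` when `x * y = 1`. -/
def symVal {K : Type*} [CommRing K] (x y : K) (j : ℕ) : K :=
  if j = 0 then 1 else (-1) ^ j * (x ^ j + y ^ j)

theorem eval_zero_symPoly {K : Type*} [CommRing K] (x y : K) (hxy : x * y = 1) (j : ℕ) :
    (symPoly (x + y) j).eval 0 = symVal x y j := by
  have h := aeval_symPoly (A := K) (x + y) (-x) (-y) 0 (by rw [neg_mul_neg, hxy])
    (by simp; ring) j
  rw [Polynomial.coe_aeval_eq_eval] at h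
  rw [h, symVal]
  split_ifs
  · rfl
  · rw [neg_pow x, neg_pow y]
    ring

open LaurentPolynomial in
/-- `pgf x y n k` is a coefficient of the `n`-th power of a Laurent polynomial. -/
theorem coeff_step_pow {K : Type*} [CommRing K] (x y : K) (n : ℕ) (k : ℤ) :
    (((T 1 + C x) * (1 + C y * T (-1))) ^ n : K[T;T⁻¹]).coeff k = pgf x y n k := by
  have h₁ : ((T 1 + C x) ^ n : K[T;T⁻¹]) =
      ∑ l ∈ Finset.range (n + 1), C ((n.choose l : K) * x ^ l) * T ((n : ℤ) - l) := by
    rw [add_comm (T 1), add_pow]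
    refine Finset.sum_congr rfl fun l hl => ?_
    have hl : l ≤ n := by simpa [Nat.lt_succ_iff] using hl
    rw [T_pow, map_mul, map_pow, map_natCast, mul_one, Nat.cast_sub hl]
    ring
  have h₂ : ((1 + C y * T (-1)) ^ n : K[T;T⁻¹]) =
      ∑ m ∈ Finset.range (n + 1), C ((n.choose m : K) * y ^ m) * T (-(m : ℤ)) := by
    rw [add_comm 1, add_pow]
    refine Finset.sum_congr rfl fun m _ => ?_
    rw [mul_pow, T_pow, map_mul, map_pow, map_natCast, one_pow, mul_neg_one]
    ring
  have h₃ : (((T 1 + C x) * (1 + C y * T (-1))) ^ n : K[T;T⁻¹]) =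
      ∑ l ∈ Finset.range (n + 1), ∑ m ∈ Finset.range (n + 1),
        AddMonoidAlgebra.single ((n : ℤ) - l - m)
          ((n.choose l : K) * (n.choose m : K) * x ^ l * y ^ m) := by
    rw [mul_pow, h₁, h₂, Finset.sum_mul_sum]
    refine Finset.sum_congr rfl fun l _ => Finset.sum_congr rfl fun m _ => ?_
    rw [single_eq_C_mul_T, sub_eq_add_neg _ (m : ℤ), T_add]
    simp only [map_mul]
    ring
  rw [h₃, pgf]
  simp only [AddMonoidAlgebra.coeff_sum, Finsupp.finsetSum_apply,
    AddMonoidAlgebra.coeff_single, Finsupp.single_apply]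
  refine Finset.sum_congr rfl fun l _ => ?_
  split_ifs with h
  · obtain ⟨m, hm⟩ := Int.eq_ofNat_of_zero_le (sub_nonneg.2 h)
    have hm' : ((n : ℤ) - k - l).toNat = m := by lia
    rw [hm']
    by_cases hmn : m ∈ Finset.range (n + 1)
    · rw [Finset.sum_eq_single_of_mem m hmn, if_pos (by lia)]
      intro b _ hb
      rw [if_neg (by lia)]
    · rw [Nat.choose_eq_zero_of_lt (show n < m by simpa using hmn), Finset.sum_eq_zero]
      · simp
      · intro b hb
        rw [if_neg]
        rintro h'
        exact hmn (by rwa [show m = b by lia])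
  · refine Finset.sum_eq_zero fun m _ => if_neg (by lia)

open LaurentPolynomial in
/-- The linear functional with moments `pgf x y n k`. -/
noncomputable def pgfForm {K : Type*} [CommRing K] (x y : K) (k : ℤ) :
    Polynomial K →ₗ[K] K where
  toFun p := (Polynomial.aeval ((T 1 + C x) * (1 + C y * T (-1)) : K[T;T⁻¹]) p).coeff k
  map_add' p q := by simp
  map_smul' r p := by simp

theorem pgfForm_X_pow {K : Type*} [CommRing K] (x y : K) (k : ℤ) (n : ℕ) :
    pgfForm x y k (Polynomial.X ^ n) = pgf x y n k := by
  simp [pgfForm, coeff_step_pow]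

/-- The matrix entry in row `i` and column `j` of `pgfForm` with respect to `symPoly`. -/
def bandEntry (K : Type*) [CommRing K] (k i j : ℕ) : K :=
  if i + j = k ∨ i + k = j ∨ j + k = i then 1 else 0

open LaurentPolynomial in
theorem aeval_step_symPoly {K : Type*} [CommRing K] (x y : K) (hxy : x * y = 1) (j : ℕ) :
    Polynomial.aeval ((T 1 + C x) * (1 + C y * T (-1)) : K[T;T⁻¹]) (symPoly (x + y) j) =
      if j = 0 then 1 else T (j : ℤ) + T (-(j : ℤ)) := by
  have hT : (T 1 * T (-1) : K[T;T⁻¹]) = 1 := by rw [← T_add]; simp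
  rw [aeval_symPoly (x + y) (T 1) (T (-1)) _ hT, T_pow, T_pow]
  · simp
  · have hC : (C x * C y : K[T;T⁻¹]) = 1 := by rw [← map_mul, hxy, map_one]
    rw [← C_eq_algebraMap, map_add]
    linear_combination C y * hT + T (-1) * hC

theorem pgfForm_symPoly_mul {K : Type*} [CommRing K] (x y : K) (hxy : x * y = 1) (k : ℕ)
    (hk : 0 < k) (i j : ℕ) :
    pgfForm x y k (symPoly (x + y) i * symPoly (x + y) j) = bandEntry K k i j := by
  simp only [pgfForm, LinearMap.coe_mk, AddHom.coe_mk, map_mul, aeval_step_symPoly x y hxy,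
    bandEntry]
  rcases Nat.eq_zero_or_pos i with rfl | hi <;> rcases Nat.eq_zero_or_pos j with rfl | hj
  · rw [if_pos rfl, mul_one, ← LaurentPolynomial.T_zero, LaurentPolynomial.T_apply]
    split_ifs <;> first | rfl | lia
  · simp only [if_true, one_mul, if_neg hj.ne', AddMonoidAlgebra.coeff_add, Finsupp.add_apply,
      LaurentPolynomial.T_apply]
    split_ifs <;> first | lia | simp
  · simp only [if_true, mul_one, if_neg hi.ne', AddMonoidAlgebra.coeff_add, Finsupp.add_apply,
      LaurentPolynomial.T_apply]
    split_ifs <;> first | lia | simp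
  · simp only [if_neg hi.ne', if_neg hj.ne', add_mul, mul_add, ← LaurentPolynomial.T_add,
      AddMonoidAlgebra.coeff_add, Finsupp.add_apply, LaurentPolynomial.T_apply]
    split_ifs <;> first | lia | simp

theorem pgfForm_zero_symPoly_mul {K : Type*} [CommRing K] (x y : K) (hxy : x * y = 1)
    (i j : ℕ) :
    pgfForm x y 0 (symPoly (x + y) i * symPoly (x + y) j) =
      if i = j then (if i = 0 then 1 else 2) else 0 := by
  simp only [pgfForm, LinearMap.coe_mk, AddHom.coe_mk, map_mul, aeval_step_symPoly x y hxy]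
  rcases Nat.eq_zero_or_pos i with rfl | hi <;> rcases Nat.eq_zero_or_pos j with rfl | hj
  · rw [if_pos rfl, if_pos rfl, mul_one, ← LaurentPolynomial.T_zero,
      LaurentPolynomial.T_apply, if_pos rfl, if_pos rfl]
  · simp only [if_true, one_mul, if_neg hj.ne', AddMonoidAlgebra.coeff_add, Finsupp.add_apply,
      LaurentPolynomial.T_apply]
    split_ifs <;> first | lia | simp
  · simp only [if_true, mul_one, if_neg hi.ne', AddMonoidAlgebra.coeff_add, Finsupp.add_apply,
      LaurentPolynomial.T_apply]
    split_ifs <;> first | lia | simp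
  · simp only [if_neg hi.ne', if_neg hj.ne', add_mul, mul_add, ← LaurentPolynomial.T_add,
      AddMonoidAlgebra.coeff_add, Finsupp.add_apply, LaurentPolynomial.T_apply]
    split_ifs <;> first | lia | norm_num

/-- The bordered matrix whose determinant is, up to sign, the Hankel determinant. -/
def borderedBand {K : Type*} [CommRing K] (x y : K) (k n : ℕ) :
    Matrix (Fin (n + 1)) (Fin (n + 1)) K :=
  Matrix.of fun i j => if i.1 < n then bandEntry K k i j else symVal x y j

theorem det_pgf_eq_det_borderedBand {K : Type*} [CommRing K] [IsDomain K] (x y : K)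
    (hxy : x * y = 1) (k n : ℕ) (hk : 0 < k) :
    Matrix.det (Matrix.of fun i j : Fin n => pgf x y (i.1 + j.1 + 1) (k : ℤ)) =
      (-1) ^ n * (borderedBand x y k n).det := by
  simp only [← pgfForm_X_pow]
  rw [det_hankel_succ_eq_bordered n (pgfForm x y k) (symPoly (x + y)) (natDegree_symPoly _)
    (symPoly_monic _)]
  simp only [pgfForm_symPoly_mul x y hxy k hk, eval_zero_symPoly x y hxy]
  rfl

theorem det_pgf_zero_of_mul_eq_one {K : Type*} [CommRing K] [IsDomain K] (x y : K)
    (hxy : x * y = 1) (n : ℕ) (hn : 0 < n) :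
    Matrix.det (Matrix.of fun i j : Fin n => pgf x y (i.1 + j.1 + 1) 0) =
      2 ^ (n - 1) * (x ^ n + y ^ n) := by
  simp only [← pgfForm_X_pow]
  rw [det_hankel_succ_eq_bordered n (pgfForm x y 0) (symPoly (x + y)) (natDegree_symPoly _)
    (symPoly_monic _)]
  simp only [pgfForm_zero_symPoly_mul x y hxy, eval_zero_symPoly x y hxy]
  rw [Matrix.det_of_isLowerTriangular, Fin.prod_univ_castSucc]
  · obtain ⟨n, rfl⟩ : ∃ m, n = m + 1 := ⟨n - 1, by lia⟩
    rw [Fin.prod_univ_succ]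
    have h : ((-1 : K) ^ (n + 1)) * (-1) ^ (n + 1) = 1 := by rw [← mul_pow]; simp
    simp [symVal]
    linear_combination (2 ^ n * (x ^ (n + 1) + y ^ (n + 1))) * h
  · intro i j hij
    have hij : i < j := hij
    simp only [Matrix.of_apply]
    rw [if_pos (by lia), if_neg (by lia)]

/-- The determinant of the antidiagonal permutation matrix. -/
theorem det_antidiagonal (K : Type*) [CommRing K] (m : ℕ) :
    Matrix.det (Matrix.of fun i j : Fin m => if i.1 + j.1 + 1 = m then (1 : K) else 0) =
      (-1) ^ m.choose 2 := by
  induction m with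
  | zero => simp
  | succ m ih =>
    rw [Matrix.det_succ_row_zero, Fin.sum_univ_castSucc, Finset.sum_eq_zero, zero_add]
    · have h : (Matrix.of fun i j : Fin (m + 1) =>
          if i.1 + j.1 + 1 = m + 1 then (1 : K) else 0).submatrix Fin.succ
            (Fin.last m).succAbove =
          Matrix.of fun i j : Fin m => if i.1 + j.1 + 1 = m then (1 : K) else 0 := by
        ext i j
        simp only [Matrix.submatrix_apply, Matrix.of_apply, Fin.val_succ, Fin.succAbove_last,
          Fin.val_castSucc]
        exact if_congr (by lia) rfl rfl
      rw [h, ih, Nat.choose_succ_succ' m 1, Nat.choose_one_right, pow_add]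
      simp
    · intro j _
      rw [Matrix.of_apply, if_neg]
      · simp
      · simp only [Fin.val_zero, Fin.val_castSucc]
        lia

/-- A block matrix whose last block row and column are unit vectors reduces, up to sign, to its
first block. -/
theorem det_fromBlocks_pendant {K : Type*} [CommRing K] {m n : Type*} [Fintype m] [Fintype n]
    [DecidableEq m] [DecidableEq n] (P : Matrix m m K) (B : Matrix m n K) (C : Matrix n m K)
    (E : Matrix n n K) :
    (Matrix.fromBlocks P (Matrix.fromCols B (0 : Matrix m n K))
      (Matrix.fromRows C (0 : Matrix n m K)) (Matrix.fromBlocks E 1 1 (0 : Matrix n n K))).det =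
      (-1) ^ Fintype.card n * P.det := by
  have hdet : (Matrix.fromBlocks E 1 1 (0 : Matrix n n K)).det = (-1) ^ Fintype.card n := by
    have h : Matrix.fromBlocks (1 : Matrix n n K) 0 1 1 *
        Matrix.fromBlocks E 1 1 (0 : Matrix n n K) =
        Matrix.fromBlocks E 1 (E + 1) 1 := by
      simp [Matrix.fromBlocks_multiply]
    have h' := congrArg Matrix.det h
    rw [Matrix.det_mul, Matrix.det_fromBlocks_one₂₂, Matrix.det_fromBlocks_one₂₂] at h'
    simpa [Matrix.det_neg] using h'
  let _ : Invertible (Matrix.fromBlocks E 1 1 (0 : Matrix n n K)) :=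
    ⟨Matrix.fromBlocks 0 1 1 (-E), by simp [Matrix.fromBlocks_multiply],
      by simp [Matrix.fromBlocks_multiply]⟩
  have hinv : ⅟(Matrix.fromBlocks E 1 1 (0 : Matrix n n K)) = Matrix.fromBlocks 0 1 1 (-E) := rfl
  rw [Matrix.det_fromBlocks₂₂, hdet, hinv, Matrix.fromCols_mul_fromBlocks,
    Matrix.fromCols_mul_fromRows]
  simp

/-- The leading `n × n` minor of the band matrix. -/
def bandMatrix (K : Type*) [CommRing K] (k n : ℕ) : Matrix (Fin n) (Fin n) K :=
  Matrix.of fun i j => bandEntry K k i j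

theorem det_bandMatrix_add (K : Type*) [CommRing K] (k n : ℕ) :
    (bandMatrix K k (n + (k + k))).det = (-1) ^ k * (bandMatrix K k n).det := by
  let e : Fin n ⊕ (Fin k ⊕ Fin k) ≃ Fin (n + (k + k)) :=
    (Equiv.sumCongr (Equiv.refl _) finSumFinEquiv).trans finSumFinEquiv
  have h : (bandMatrix K k (n + (k + k))).submatrix e e = Matrix.fromBlocks (bandMatrix K k n)
      (Matrix.fromCols (Matrix.of fun (i : Fin n) (j : Fin k) => bandEntry K k i (n + j))
        (0 : Matrix _ (Fin k) K))
      (Matrix.fromRows (Matrix.of fun (i : Fin k) (j : Fin n) => bandEntry K k (n + i) j)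
        (0 : Matrix (Fin k) _ K))
      (Matrix.fromBlocks (Matrix.of fun i j : Fin k => bandEntry K k (n + i) (n + j)) 1 1
        (0 : Matrix (Fin k) (Fin k) K)) := by
    ext i j
    rcases i with i | i | i <;> rcases j with j | j | j <;>
      simp only [Matrix.submatrix_apply, Matrix.fromBlocks_apply₁₁, Matrix.fromBlocks_apply₁₂,
        Matrix.fromBlocks_apply₂₁, Matrix.fromBlocks_apply₂₂, Matrix.fromCols_apply_inl,
        Matrix.fromCols_apply_inr, Matrix.fromRows_apply_inl, Matrix.fromRows_apply_inr,
        Matrix.of_apply, bandMatrix, bandEntry, Matrix.one_apply, Matrix.zero_apply,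
        Equiv.trans_apply, Equiv.sumCongr_apply, Sum.map_inl, Sum.map_inr, Equiv.refl_apply,
        finSumFinEquiv_apply_left, finSumFinEquiv_apply_right, Fin.val_castAdd, Fin.val_natAdd,
        Fin.ext_iff, e] <;>
      split_ifs <;> first | rfl | lia
  rw [← Matrix.det_submatrix_equiv_self e, h, det_fromBlocks_pendant, Fintype.card_fin]

theorem det_bandMatrix_mul_add (K : Type*) [CommRing K] (k r N n : ℕ) (hn : n = 2 * k * N + r) :
    (bandMatrix K k n).det = (-1) ^ (k * N) * (bandMatrix K k r).det := by
  induction N generalizing n with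
  | zero =>
    obtain rfl : n = r := by lia
    simp
  | succ N ih =>
    obtain rfl : n = 2 * k * N + r + (k + k) := by lia
    rw [det_bandMatrix_add, ih _ rfl]
    ring

theorem det_bandMatrix_zero_mod (K : Type*) [CommRing K] (k N : ℕ) :
    (bandMatrix K k (2 * k * N)).det = (-1) ^ (k * N) := by
  simpa using det_bandMatrix_mul_add K k 0 N _ rfl

theorem det_bandMatrix_succ_mod (K : Type*) [CommRing K] (k N : ℕ) :
    (bandMatrix K k (2 * k * N + (k + 1))).det = (-1) ^ (k * N + (k + 1).choose 2) := by
  have h : bandMatrix K k (k + 1) =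
      Matrix.of fun i j : Fin (k + 1) => if i.1 + j.1 + 1 = k + 1 then (1 : K) else 0 := by
    ext i j
    exact if_congr (by lia) rfl rfl
  rw [det_bandMatrix_mul_add K k (k + 1) N _ rfl, h, det_antidiagonal, pow_add]

/-- Replacing a row of `A` by `c`: the determinant is found from a vector whose image under `A` is
concentrated at this row. -/
theorem mul_det_updateRow_of_mulVec_eq_single {K : Type*} [CommRing K] {m : Type*} [Fintype m]
    [DecidableEq m] (A : Matrix m m K) (i : m) (c v : m → K) (a : K)
    (h : A.mulVec v = Pi.single i a) :
    a * (A.updateRow i c).det = A.det * ∑ j, c j * v j := by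
  have hadj (j : m) : A.adjugate j i * a = A.det * v j := by
    have h' := congrFun (congrArg A.adjugate.mulVec h) j
    rw [Matrix.mulVec_mulVec, Matrix.adjugate_mul, Matrix.smul_mulVec, Matrix.one_mulVec] at h'
    simpa using h'.symm
  rw [← Matrix.cramer_transpose_apply, Matrix.cramer_eq_adjugate_mulVec,
    ← Matrix.adjugate_transpose, Matrix.mulVec, dotProduct, Finset.mul_sum, Finset.mul_sum]
  refine Finset.sum_congr rfl fun j _ => ?_
  rw [Matrix.transpose_apply]
  linear_combination c j * hadj j

theorem borderedBand_eq_updateRow {K : Type*} [CommRing K] (x y : K) (k n : ℕ)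
    (b : Fin (n + 1) → K) :
    borderedBand x y k n = ((bandMatrix K k (n + 1)).updateRow (Fin.last n) b).updateRow
      (Fin.last n) fun j => symVal x y j := by
  ext i j
  rw [Matrix.updateRow_apply, Matrix.updateRow_apply]
  by_cases h : i = Fin.last n
  · simp [h, borderedBand]
  · simp [h, borderedBand, bandMatrix, Fin.val_lt_last h]

theorem mul_det_borderedBand_of_last_row {K : Type*} [CommRing K] (x y : K) (k n : ℕ)
    (v : ℕ → K) (a : K)
    (h : ∀ i ≤ n, ∑ j : Fin (n + 1), bandEntry K k i j * v j = if i = n then a else 0) :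
    a * (borderedBand x y k n).det =
      (bandMatrix K k (n + 1)).det * ∑ j : Fin (n + 1), symVal x y j * v j := by
  rw [borderedBand_eq_updateRow x y k n (bandMatrix K k (n + 1) (Fin.last n)),
    Matrix.updateRow_eq_self]
  refine mul_det_updateRow_of_mulVec_eq_single _ _ _ (fun j : Fin (n + 1) => v j) a
    (funext fun i => ?_)
  rw [Pi.single_apply, if_congr (Fin.ext_iff (b := Fin.last n)) rfl rfl]
  exact h i (by lia)

theorem mul_det_borderedBand_of_kernel {K : Type*} [CommRing K] (x y : K) (k n : ℕ) (v : ℕ → K)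
    (h : ∀ i < n, ∑ j : Fin (n + 1), bandEntry K k i j * v j = 0) :
    v n * (borderedBand x y k n).det =
      (bandMatrix K k n).det * ∑ j : Fin (n + 1), symVal x y j * v j := by
  have hdet : ((bandMatrix K k (n + 1)).updateRow (Fin.last n) (Pi.single (Fin.last n) 1)).det =
      (bandMatrix K k n).det := by
    rw [← Matrix.adjugate_apply, Matrix.adjugate_fin_succ_eq_det_submatrix, ← two_mul, pow_mul,
      neg_one_sq, one_pow, one_mul]
    congr 1
    ext i j
    simp [bandMatrix]
  rw [borderedBand_eq_updateRow x y k n (Pi.single (Fin.last n) 1), ← hdet]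
  refine mul_det_updateRow_of_mulVec_eq_single _ _ _ (fun j : Fin (n + 1) => v j) _
    (funext fun i => ?_)
  rw [Matrix.mulVec, dotProduct]
  by_cases hi : i = Fin.last n
  · subst hi
    simp [Pi.single_apply]
  · rw [Matrix.updateRow_ne hi, Pi.single_eq_of_ne hi]
    exact h i (Fin.val_lt_last hi)

theorem det_borderedBand_eq_zero {K : Type*} [CommRing K] [IsDomain K] (x y : K) (k n : ℕ)
    (v : ℕ → K) (h : ∀ i ≤ n, ∑ j : Fin (n + 1), bandEntry K k i j * v j = 0) (hn : v n = 0)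
    (p : ℕ) (hp : p ≤ n) (hvp : v p ≠ 0) : (borderedBand x y k n).det = 0 := by
  refine Matrix.exists_vecMul_eq_zero_iff.1 ⟨fun j => v j, fun h0 => hvp ?_, funext fun j => ?_⟩
  · exact congrFun h0 ⟨p, by lia⟩
  · rw [Pi.zero_apply, ← h j (by lia), Matrix.vecMul, dotProduct]
    refine Finset.sum_congr rfl fun i _ => ?_
    by_cases hi : i.1 < n
    · rw [borderedBand, Matrix.of_apply, if_pos hi, mul_comm]
      congr 1
      exact if_congr (by lia) rfl rfl
    · rw [show (i : ℕ) = n by lia, hn, zero_mul, mul_zero]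

/-- The vector with alternating entries `1, -1, …` at the positions `p 0, …, p N`. -/
def altVec (K : Type*) [CommRing K] (p : ℕ → ℕ) (N j : ℕ) : K :=
  ∑ s ∈ Finset.range (N + 1), if j = p s then (-1) ^ s else 0

theorem sum_mul_altVec {K : Type*} [CommRing K] (p : ℕ → ℕ) (N m : ℕ) (r : ℕ → K)
    (hp : ∀ s ≤ N, p s < m) :
    ∑ j : Fin m, r j * altVec K p N j = ∑ s ∈ Finset.range (N + 1), (-1) ^ s * r (p s) := by
  simp only [altVec, Finset.mul_sum]
  rw [Finset.sum_comm]
  refine Finset.sum_congr rfl fun s hs => ?_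
  have hs : p s < m := hp s (by simpa [Nat.lt_succ_iff] using hs)
  rw [Finset.sum_eq_single_of_mem (⟨p s, hs⟩ : Fin m) (Finset.mem_univ _)]
  · simp [mul_comm]
  · intro b _ hb
    rw [if_neg (fun h => hb (Fin.ext h)), mul_zero]

theorem altVec_apply {K : Type*} [CommRing K] (p : ℕ → ℕ) (hp : Function.Injective p) (N s : ℕ)
    (hs : s ≤ N) : altVec K p N (p s) = (-1) ^ s := by
  simp only [altVec, hp.eq_iff]
  rw [Finset.sum_ite_eq, if_pos (by simpa [Nat.lt_succ_iff] using hs)]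

theorem altVec_eq_zero {K : Type*} [CommRing K] (p : ℕ → ℕ) (N j : ℕ)
    (hj : ∀ s ≤ N, p s ≠ j) : altVec K p N j = 0 :=
  Finset.sum_eq_zero fun s hs =>
    if_neg fun h => hj s (by simpa [Nat.lt_succ_iff] using hs) h.symm

theorem bandEntry_eq_add (K : Type*) [CommRing K] (k i j : ℕ) (hk : 0 < k) (hj : 0 < j) :
    bandEntry K k i j =
      (if i = j + k then 1 else 0) + if i + k = j ∨ i + j = k then 1 else 0 := by
  unfold bandEntry
  split_ifs <;> first | lia | simp

theorem sum_bandEntry_mul_altVec (K : Type*) [CommRing K] (k i N m : ℕ) (hk : 0 < k)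
    (hm : 2 * k * N < m) :
    ∑ j : Fin m, bandEntry K k i j * altVec K (fun s => 2 * k * s) N j =
      if i = 2 * k * N + k then (-1) ^ N else 0 := by
  rw [sum_mul_altVec _ _ _ (bandEntry K k i)
    fun s hs => lt_of_le_of_lt (Nat.mul_le_mul_left _ hs) hm]
  clear hm
  induction N with
  | zero =>
    simp only [zero_add, Finset.sum_range_one, mul_zero, pow_zero, one_mul, bandEntry]
    exact if_congr (by lia) rfl rfl
  | succ N ih =>
    have h : bandEntry K k i (2 * k * (N + 1)) =
        (if i = 2 * k * (N + 1) + k then 1 else 0) + if i = 2 * k * N + k then 1 else 0 := by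
      rw [bandEntry_eq_add K k i _ hk (by positivity)]
      congr 1
      exact if_congr (by rw [mul_add]; lia) rfl rfl
    rw [Finset.sum_range_succ, ih, h, pow_succ]
    split_ifs <;> ring

/-- The vector with entries `±1` at the positions congruent to `± (k + 1)` modulo `2 * k`. -/
def altVecPair (K : Type*) [CommRing K] (k N j : ℕ) : K :=
  altVec K (fun s => 2 * k * s + (k + 1)) N j - altVec K (fun s => 2 * k * s + (k - 1)) N j

theorem sum_mul_altVecPair {K : Type*} [CommRing K] (k N m : ℕ) (r : ℕ → K)
    (hm : 2 * k * N + (k + 1) < m) :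
    ∑ j : Fin m, r j * altVecPair K k N j = ∑ s ∈ Finset.range (N + 1),
      (-1) ^ s * (r (2 * k * s + (k + 1)) - r (2 * k * s + (k - 1))) := by
  simp only [altVecPair, mul_sub, Finset.sum_sub_distrib]
  have hle (s : ℕ) (hs : s ≤ N) : 2 * k * s ≤ 2 * k * N := Nat.mul_le_mul_left _ hs
  rw [sum_mul_altVec _ _ _ r fun s hs => ?_, sum_mul_altVec _ _ _ r fun s hs => ?_]
  · have := hle s hs
    lia
  · have := hle s hs
    lia

theorem sum_bandEntry_mul_altVecPair (K : Type*) [CommRing K] (k i N m : ℕ) (hk : 2 ≤ k)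
    (hm : 2 * k * N + (k + 1) < m) :
    ∑ j : Fin m, bandEntry K k i j * altVecPair K k N j =
      (if i = 2 * k * N + (2 * k + 1) then (-1) ^ N else 0) -
        if i = 2 * k * N + (2 * k - 1) then (-1) ^ N else 0 := by
  rw [sum_mul_altVecPair k N m (bandEntry K k i) hm]
  clear hm
  induction N with
  | zero =>
    simp only [zero_add, Finset.sum_range_one, mul_zero, pow_zero, one_mul, bandEntry]
    split_ifs <;> first | lia | simp
  | succ N ih =>
    rw [Finset.sum_range_succ, ih, bandEntry_eq_add K k i _ (by lia) (by lia),
      bandEntry_eq_add K k i _ (by lia) (by lia), pow_succ, mul_add (2 * k) N 1]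
    generalize 2 * k * N = q
    have h₁ : (if i + k = q + 2 * k * 1 + (k + 1) ∨ i + (q + 2 * k * 1 + (k + 1)) = k then
        (1 : K) else 0) = if i = q + (2 * k + 1) then 1 else 0 := if_congr (by lia) rfl rfl
    have h₂ : (if i + k = q + 2 * k * 1 + (k - 1) ∨ i + (q + 2 * k * 1 + (k - 1)) = k then
        (1 : K) else 0) = if i = q + (2 * k - 1) then 1 else 0 := if_congr (by lia) rfl rfl
    have h₃ : (i = q + 2 * k * 1 + (k + 1) + k) ↔ i = q + 2 * k * 1 + (2 * k + 1) := by lia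
    have h₄ : (i = q + 2 * k * 1 + (k - 1) + k) ↔ i = q + 2 * k * 1 + (2 * k - 1) := by lia
    simp only [h₁, h₂, h₃, h₄]
    split_ifs <;> first | lia | ring

theorem sum_symVal_mul {K : Type*} [CommRing K] (x y : K) (hxy : x * y = 1) (k N : ℕ)
    (hk : 0 < k) :
    ∑ s ∈ Finset.range (N + 1), (-1) ^ s * symVal x y (2 * k * s) =
      (-1) ^ N * ppoly x y (2 * k * N) k := by
  have hdiv (N : ℕ) : 2 * k * N / k = 2 * N := by
    rw [show 2 * k * N = 2 * N * k by ring, Nat.mul_div_cancel _ hk]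
  have hdvd (N : ℕ) : k ∣ 2 * k * N := ⟨2 * N, by ring⟩
  induction N with
  | zero => simp [symVal, ppoly]
  | succ N ih =>
    have h : ppoly x y (2 * k * (N + 1)) k =
        x ^ (2 * k * (N + 1)) + y ^ (2 * k * (N + 1)) - ppoly x y (2 * k * N) k := by
      rw [ppoly, ppoly, if_pos (hdvd _), if_pos (hdvd _), hdiv, hdiv,
        show 2 * (N + 1) + 1 = 2 * N + 1 + 1 + 1 by ring, Finset.sum_range_succ,
        Finset.sum_range_succ']
      have hmid : ∑ s ∈ Finset.range (2 * N + 1), (-1 : K) ^ (s + 1) *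
          (x ^ ((s + 1) * k) * y ^ (2 * k * (N + 1) - (s + 1) * k)) =
          -∑ s ∈ Finset.range (2 * N + 1), (-1 : K) ^ s *
            (x ^ (s * k) * y ^ (2 * k * N - s * k)) := by
        rw [← Finset.sum_neg_distrib]
        refine Finset.sum_congr rfl fun s hs => ?_
        have hs : s ≤ 2 * N := by simpa [Nat.lt_succ_iff] using hs
        have hs' : s * k ≤ 2 * k * N := by nlinarith
        rw [show 2 * k * (N + 1) - (s + 1) * k = 2 * k * N - s * k + k by
          rw [mul_add, add_mul]; lia, pow_add, add_mul, one_mul, pow_add x]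
        have hk' : x ^ k * y ^ k = 1 := by rw [← mul_pow, hxy, one_pow]
        linear_combination (-(-1) ^ s * x ^ (s * k) * y ^ (2 * k * N - s * k)) * hk'
      have hlast : (2 * N + 1 + 1) * k = 2 * k * (N + 1) := by ring
      have hsign : (-1 : K) ^ (2 * N + 1 + 1) = 1 := by
        rw [show 2 * N + 1 + 1 = 2 * (N + 1) by ring, pow_mul]
        simp
      rw [hmid, hlast, hsign]
      simp
      ring
    have hsym : symVal x y (2 * k * (N + 1)) = x ^ (2 * k * (N + 1)) + y ^ (2 * k * (N + 1)) := by
      have hne : 2 * k * (N + 1) ≠ 0 := by positivity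
      rw [symVal, if_neg hne, mul_assoc 2 k, pow_mul (-1 : K)]
      simp
    rw [Finset.sum_range_succ, ih, hsym, h, pow_succ]
    ring

theorem sum_symVal_sub {K : Type*} [CommRing K] (x y : K) (hxy : x * y = 1) (k N : ℕ)
    (hk : 2 ≤ k) :
    ∑ s ∈ Finset.range (N + 1), (-1) ^ s *
        (symVal x y (2 * k * s + (k + 1)) - symVal x y (2 * k * s + (k - 1))) =
      (-1) ^ (N + k + 1) * ppoly x y (2 * k * N + (k + 1)) k := by
  obtain ⟨k, rfl⟩ : ∃ l, k = l + 1 := ⟨k - 1, by lia⟩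
  have hdiv (N : ℕ) : (2 * (k + 1) * N + (k + 1 + 1)) / (k + 1) = 2 * N + 1 := by
    rw [show 2 * (k + 1) * N + (k + 1 + 1) = 1 + (2 * N + 1) * (k + 1) by ring,
      Nat.add_mul_div_right _ _ (by lia), Nat.div_eq_of_lt (by lia), zero_add]
  have hdvd (N : ℕ) : ¬ k + 1 ∣ 2 * (k + 1) * N + (k + 1 + 1) := by
    rw [show 2 * (k + 1) * N + (k + 1 + 1) = 1 + (2 * N + 1) * (k + 1) by ring,
      Nat.dvd_add_left (Dvd.intro_left _ rfl), Nat.dvd_one]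
    lia
  have hsym (N : ℕ) :
      symVal x y (2 * (k + 1) * N + (k + 1 + 1)) - symVal x y (2 * (k + 1) * N + (k + 1 - 1)) =
        (-1) ^ k * ((x ^ (2 * (k + 1) * N + (k + 1 + 1)) + y ^ (2 * (k + 1) * N + (k + 1 + 1))) -
          (x ^ (2 * (k + 1) * N + k) + y ^ (2 * (k + 1) * N + k))) := by
    rw [Nat.add_sub_cancel, symVal, symVal, if_neg (by lia), if_neg (by lia),
      show 2 * (k + 1) * N = 2 * ((k + 1) * N) by ring]
    simp only [pow_add (-1 : K), pow_mul (-1 : K), neg_one_sq, one_pow]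
    ring
  have hlast (N : ℕ) :
      x ^ ((2 * N + 1) * (k + 1)) *
          y ^ (2 * (k + 1) * N + (k + 1 + 1) - (2 * N + 1) * (k + 1)) +
        x ^ (2 * (k + 1) * N + (k + 1 + 1) - (2 * N + 1) * (k + 1)) *
          y ^ ((2 * N + 1) * (k + 1)) =
      x ^ (2 * (k + 1) * N + k) + y ^ (2 * (k + 1) * N + k) := by
    have h₁ : (2 * N + 1) * (k + 1) = 2 * (k + 1) * N + k + 1 := by ring
    rw [h₁, show 2 * (k + 1) * N + (k + 1 + 1) - (2 * (k + 1) * N + k + 1) = 1 by lia,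
      pow_one, pow_one, pow_succ x, pow_succ y]
    linear_combination (x ^ (2 * (k + 1) * N + k) + y ^ (2 * (k + 1) * N + k)) * hxy
  induction N with
  | zero =>
    have h := hlast 0
    simp only [mul_zero, zero_add, one_mul] at h
    rw [zero_add, Finset.sum_range_one, hsym, ppoly, if_neg (hdvd 0), hdiv,
      Finset.sum_range_succ, mul_zero, zero_add, Finset.sum_range_one, zero_add, one_mul, h]
    simp
    ring
  | succ N ih =>
    have h : ppoly x y (2 * (k + 1) * (N + 1) + (k + 1 + 1)) (k + 1) =
        (x ^ (2 * (k + 1) * (N + 1) + (k + 1 + 1)) +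
          y ^ (2 * (k + 1) * (N + 1) + (k + 1 + 1))) -
          (x ^ (2 * (k + 1) * (N + 1) + k) + y ^ (2 * (k + 1) * (N + 1) + k)) -
          ppoly x y (2 * (k + 1) * N + (k + 1 + 1)) (k + 1) := by
      rw [ppoly, ppoly, if_neg (hdvd _), if_neg (hdvd _), hdiv, hdiv, Finset.sum_range_succ,
        hlast, show 2 * (N + 1) + 1 = 2 * N + 1 + 1 + 1 by ring, Finset.sum_range_succ']
      have hmid : ∑ s ∈ Finset.range (2 * N + 1 + 1), (-1 : K) ^ (s + 1) *
          (x ^ ((s + 1) * (k + 1)) *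
              y ^ (2 * (k + 1) * (N + 1) + (k + 1 + 1) - (s + 1) * (k + 1)) +
            x ^ (2 * (k + 1) * (N + 1) + (k + 1 + 1) - (s + 1) * (k + 1)) *
              y ^ ((s + 1) * (k + 1))) =
          -∑ s ∈ Finset.range (2 * N + 1 + 1), (-1 : K) ^ s *
            (x ^ (s * (k + 1)) * y ^ (2 * (k + 1) * N + (k + 1 + 1) - s * (k + 1)) +
              x ^ (2 * (k + 1) * N + (k + 1 + 1) - s * (k + 1)) * y ^ (s * (k + 1))) := by
        rw [← Finset.sum_neg_distrib]
        refine Finset.sum_congr rfl fun s hs => ?_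
        have hs : s ≤ 2 * N + 1 := by simpa [Nat.lt_succ_iff] using hs
        have hs' : s * (k + 1) ≤ 2 * (k + 1) * N + (k + 1 + 1) := by nlinarith
        have hk' : x ^ (k + 1) * y ^ (k + 1) = 1 := by rw [← mul_pow, hxy, one_pow]
        rw [show 2 * (k + 1) * (N + 1) + (k + 1 + 1) - (s + 1) * (k + 1) =
          2 * (k + 1) * N + (k + 1 + 1) - s * (k + 1) + (k + 1) by
            rw [mul_add _ N, add_mul s]; lia,
          show (s + 1) * (k + 1) = s * (k + 1) + (k + 1) by ring]
        generalize s * (k + 1) = p at *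
        generalize 2 * (k + 1) * N + (k + 1 + 1) - p = q
        rw [pow_add x p, pow_add y p, pow_add x q, pow_add y q, pow_succ]
        linear_combination (-(-1) ^ s * (x ^ p * y ^ q + x ^ q * y ^ p)) * hk'
      have hsign : (-1 : K) ^ (2 * N + 1 + 1 + 1) = -1 := by
        rw [show 2 * N + 1 + 1 + 1 = 2 * (N + 1) + 1 by ring, pow_add, pow_mul]
        simp
      rw [hmid, hsign]
      simp
      ring
    rw [Finset.sum_range_succ, ih, hsym, h]
    ring

/-- The determinant of the Hankel matrix with entries `pgf x y (i + j + 1) k`. -/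
def pgfDet {R : Type*} [CommRing R] (x y : R) (n : ℕ) (k : ℤ) : R :=
  Matrix.det (Matrix.of fun i j : Fin n => pgf x y (i.1 + j.1 + 1) k)

theorem neg_one_pow_mul_self {K : Type*} [CommRing K] (n : ℕ) : (-1 : K) ^ n * (-1) ^ n = 1 := by
  rw [← mul_pow]
  simp

theorem neg_one_pow_two_mul_mul {K : Type*} [CommRing K] (k N : ℕ) :
    (-1 : K) ^ (2 * k * N) = 1 := by
  rw [mul_assoc, pow_mul]
  simp

theorem injective_two_mul_mul_add (k r : ℕ) (hk : 0 < k) :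
    Function.Injective fun s => 2 * k * s + r := fun a b h =>
  Nat.eq_of_mul_eq_mul_left (show 0 < 2 * k by lia) (Nat.add_right_cancel h)

theorem pgfDet_mod_zero {K : Type*} [CommRing K] [IsDomain K] (x y : K) (hxy : x * y = 1)
    (k N n : ℕ) (hk : 0 < k) (hn : n = 2 * k * N) :
    pgfDet x y n k = (-1) ^ (k * N) * ppoly x y n k := by
  subst hn
  have h := mul_det_borderedBand_of_kernel x y k (2 * k * N) (altVec K (fun s => 2 * k * s) N)
    fun i hi => by
      rw [sum_bandEntry_mul_altVec K k i N _ hk (by lia), if_neg (by lia)]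
  rw [altVec_apply (fun s => 2 * k * s) (injective_two_mul_mul_add k 0 hk) N N le_rfl,
    sum_mul_altVec _ _ _ (symVal x y) fun s hs => Nat.lt_succ_of_le (Nat.mul_le_mul_left _ hs),
    sum_symVal_mul x y hxy k N hk, det_bandMatrix_zero_mod] at h
  have hs := neg_one_pow_mul_self (K := K) N
  rw [pgfDet, det_pgf_eq_det_borderedBand x y hxy k _ hk, neg_one_pow_two_mul_mul, one_mul]
  linear_combination (-1) ^ N * h +
    ((-1) ^ (k * N) * ppoly x y (2 * k * N) k - (borderedBand x y k (2 * k * N)).det) * hs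

theorem pgfDet_mod_self {K : Type*} [CommRing K] [IsDomain K] (x y : K) (hxy : x * y = 1)
    (k N n : ℕ) (hk : 0 < k) (hn : n = 2 * k * N + k) :
    pgfDet x y n k = (-1) ^ (k * (N + 1) + (k + 1).choose 2) * ppoly x y (2 * k * N) k := by
  subst hn
  have h := mul_det_borderedBand_of_last_row x y k (2 * k * N + k)
    (altVec K (fun s => 2 * k * s) N) ((-1) ^ N)
    fun i hi => sum_bandEntry_mul_altVec K k i N _ hk (by lia)
  have hD : (bandMatrix K k (2 * k * N + k + 1)).det = (-1) ^ (k * N + (k + 1).choose 2) :=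
    det_bandMatrix_succ_mod K k N
  rw [sum_mul_altVec _ _ _ (symVal x y) fun s hs =>
      lt_of_le_of_lt (Nat.mul_le_mul_left _ hs) (by lia),
    sum_symVal_mul x y hxy k N hk, hD, pow_add] at h
  have hs := neg_one_pow_mul_self (K := K) N
  rw [pgfDet, det_pgf_eq_det_borderedBand x y hxy k _ hk, pow_add, neg_one_pow_two_mul_mul,
    one_mul, mul_add, mul_one, pow_add, pow_add]
  linear_combination (-1) ^ k * (-1) ^ N * h +
    (-1) ^ k * ((-1) ^ (k * N) * (-1) ^ (k + 1).choose 2 * ppoly x y (2 * k * N) k -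
      (borderedBand x y k (2 * k * N + k)).det) * hs

theorem pgfDet_mod_succ {K : Type*} [CommRing K] [IsDomain K] (x y : K) (hxy : x * y = 1)
    (k N n : ℕ) (hk : 2 ≤ k) (hn : n = 2 * k * N + (k + 1)) :
    pgfDet x y n k = (-1) ^ (k * N + (k + 1).choose 2) * ppoly x y n k := by
  subst hn
  have h := mul_det_borderedBand_of_kernel x y k (2 * k * N + (k + 1)) (altVecPair K k N)
    fun i hi => by
      rw [sum_bandEntry_mul_altVecPair K k i N _ hk (by lia), if_neg (by lia), if_neg (by lia),
        sub_zero]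
  have htop : altVecPair K k N (2 * k * N + (k + 1)) = (-1) ^ N := by
    rw [altVecPair, altVec_eq_zero (fun s => 2 * k * s + (k - 1)) N, sub_zero]
    · exact altVec_apply (fun s => 2 * k * s + (k + 1))
        (injective_two_mul_mul_add k (k + 1) (by lia)) N N le_rfl
    · intro s hs
      have := Nat.mul_le_mul_left (2 * k) hs
      lia
  rw [htop, sum_mul_altVecPair k N _ (symVal x y) (by lia), sum_symVal_sub x y hxy k N hk,
    det_bandMatrix_succ_mod, pow_add _ (N + k), pow_add _ N] at h
  have hs := neg_one_pow_mul_self (K := K) N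
  have hs' := neg_one_pow_mul_self (K := K) k
  rw [pgfDet, det_pgf_eq_det_borderedBand x y hxy k _ (by lia), pow_add,
    neg_one_pow_two_mul_mul, one_mul, pow_add _ k 1]
  generalize (-1 : K) ^ (k * N + (k + 1).choose 2) = d at *
  generalize ppoly x y (2 * k * N + (k + 1)) k = P at *
  generalize (borderedBand x y k (2 * k * N + (k + 1))).det = B at *
  linear_combination -(-1) ^ k * (-1) ^ N * h + ((-1) ^ k * B + d * P * (-1) ^ k * (-1) ^ k) * hs +
    d * P * hs'

theorem pgfDet_mod_neg_one {K : Type*} [CommRing K] [IsDomain K] (x y : K) (hxy : x * y = 1)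
    (k N n : ℕ) (hk : 2 ≤ k) (hn : n + 1 = 2 * k * (N + 1)) :
    pgfDet x y n k = (-1) ^ (k * N + 1) * ppoly x y (2 * k * N + (k + 1)) k := by
  have hn' : n = 2 * k * N + (2 * k - 1) := by
    rw [mul_add] at hn
    lia
  have h := mul_det_borderedBand_of_last_row x y k n (altVecPair K k N) (-(-1) ^ N)
    fun i hi => by
      rw [sum_bandEntry_mul_altVecPair K k i N _ hk (by lia), if_neg (by lia), hn']
      split_ifs <;> simp
  have hD : (bandMatrix K k (n + 1)).det = (-1) ^ (k * (N + 1)) := by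
    rw [det_bandMatrix_mul_add K k 0 (N + 1) (n + 1) (by lia)]
    simp
  rw [sum_mul_altVecPair k N _ (symVal x y) (by lia), sum_symVal_sub x y hxy k N hk, hD,
    mul_add k N 1, pow_add _ (k * N), pow_add _ (N + k),
    pow_add _ N] at h
  have hs := neg_one_pow_mul_self (K := K) N
  have hs' := neg_one_pow_mul_self (K := K) k
  have hodd : (-1 : K) ^ n = -1 := Odd.neg_one_pow ⟨k * N + (k - 1), by rw [hn', mul_assoc]; lia⟩
  rw [pgfDet, det_pgf_eq_det_borderedBand x y hxy k _ (by lia), hodd, pow_add]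
  generalize ppoly x y (2 * k * N + (k + 1)) k = P at *
  generalize (borderedBand x y k n).det = B at *
  simp only [mul_one, pow_one] at h ⊢
  linear_combination (-1) ^ N * h + (B - (-1) ^ (k * N) * P * (-1) ^ k * (-1) ^ k) * hs -
    (-1) ^ (k * N) * P * hs'

theorem pgfDet_eq_zero_of_mul_eq_one {K : Type*} [CommRing K] [IsDomain K] (x y : K)
    (hxy : x * y = 1) (k n : ℕ) (hk : 2 ≤ k) (h₀ : n % (2 * k) ≠ 0) (h₁ : n % (2 * k) ≠ k)
    (h₂ : n % (2 * k) ≠ k + 1) (h₃ : n % (2 * k) ≠ 2 * k - 1) : pgfDet x y n k = 0 := by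
  have hn := Nat.div_add_mod n (2 * k)
  have hlt := Nat.mod_lt n (show 0 < 2 * k by lia)
  generalize n / (2 * k) = N at hn
  generalize n % (2 * k) = r at *
  have hle (s : ℕ) (hs : s ≤ N) : 2 * k * s ≤ 2 * k * N := Nat.mul_le_mul_left _ hs
  have hone : ((-1 : K) ^ N) ≠ 0 := pow_ne_zero _ (by simp)
  rw [pgfDet, det_pgf_eq_det_borderedBand x y hxy k _ (by lia)]
  rcases lt_or_gt_of_ne h₁ with hr | hr
  · rw [det_borderedBand_eq_zero x y k n (altVec K (fun s => 2 * k * s) N) _ _ (2 * k * N)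
      (by lia), mul_zero]
    · rwa [altVec_apply (fun s => 2 * k * s) (injective_two_mul_mul_add k 0 (by lia)) N N le_rfl]
    · intro i hi
      rw [sum_bandEntry_mul_altVec K k i N _ (by lia) (by lia), if_neg (by lia)]
    · refine altVec_eq_zero _ _ _ fun s hs => ?_
      have := hle s hs
      lia
  · rw [det_borderedBand_eq_zero x y k n (altVecPair K k N) _ _ (2 * k * N + (k + 1))
      (by lia), mul_zero]
    · rw [altVecPair, altVec_apply (fun s => 2 * k * s + (k + 1))
        (injective_two_mul_mul_add k (k + 1) (by lia)) N N le_rfl, altVec_eq_zero, sub_zero]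
      · exact hone
      · intro s hs
        have := hle s hs
        lia
    · intro i hi
      rw [sum_bandEntry_mul_altVecPair K k i N _ hk (by lia), if_neg (by lia), if_neg (by lia),
        sub_zero]
    · rw [altVecPair, altVec_eq_zero, altVec_eq_zero, sub_zero]
      all_goals
        intro s hs
        have := hle s hs
        lia

theorem map_pgf {R S : Type*} [CommRing R] [CommRing S] (f : R →+* S) (x y : R) (n : ℕ) (k : ℤ) :
    f (pgf x y n k) = pgf (f x) (f y) n k := by
  simp only [pgf, map_sum]
  refine Finset.sum_congr rfl fun l _ => ?_
  split_ifs <;> simp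

theorem map_pgfDet {R S : Type*} [CommRing R] [CommRing S] (f : R →+* S) (x y : R) (n : ℕ)
    (k : ℤ) : f (pgfDet x y n k) = pgfDet (f x) (f y) n k := by
  rw [pgfDet, RingHom.map_det]
  congr 1
  ext i j
  simp [map_pgf]

theorem map_ppoly {R S : Type*} [CommRing R] [CommRing S] (f : R →+* S) (x y : R) (m k : ℕ) :
    f (ppoly x y m k) = ppoly (f x) (f y) m k := by
  unfold ppoly
  split_ifs <;> simp

theorem pgf_mul_mul {K : Type*} [Field K] (b x y : K) (n : ℕ) (k : ℤ) :
    pgf (b * x) (b * y) n k = b ^ ((n : ℤ) - k) * pgf x y n k := by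
  simp only [pgf, Finset.mul_sum]
  refine Finset.sum_congr rfl fun l _ => ?_
  split_ifs with h
  · obtain ⟨m, hm⟩ := Int.eq_ofNat_of_zero_le (sub_nonneg.2 h)
    have hb : b ^ ((n : ℤ) - k) = b ^ (l + m) := by
      rw [← zpow_natCast]
      congr 1
      push_cast
      linarith
    rw [hm, Int.toNat_natCast, hb]
    ring
  · simp

theorem pgfDet_mul_mul {K : Type*} [Field K] (b x y : K) (hb : b ≠ 0) (n : ℕ) (k : ℤ) :
    pgfDet (b * x) (b * y) n k = b ^ ((n : ℤ) * (n - k)) * pgfDet x y n k := by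
  have hentry : (Matrix.of fun i j : Fin n => pgf (b * x) (b * y) (i.1 + j.1 + 1) k) =
      Matrix.of fun i j : Fin n => b ^ (i.1 : ℤ) *
        (Matrix.of fun i j : Fin n => b ^ ((j.1 : ℤ) + 1 - k) *
          (Matrix.of fun i j : Fin n => pgf x y (i.1 + j.1 + 1) k) i j) i j := by
    ext i j
    simp only [Matrix.of_apply]
    rw [pgf_mul_mul, ← mul_assoc, ← zpow_add₀ hb]
    congr 2
    push_cast
    ring
  have hprod : (∏ i : Fin n, b ^ (i.1 : ℤ)) * ∏ i : Fin n, b ^ ((i.1 : ℤ) + 1 - k) =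
      b ^ ((n : ℤ) * (n - k)) := by
    rw [← Finset.prod_mul_distrib,
      Fin.prod_univ_eq_prod_range (fun i => b ^ (i : ℤ) * b ^ ((i : ℤ) + 1 - k)) n]
    clear hentry
    induction n with
    | zero => simp
    | succ n ih =>
      rw [Finset.prod_range_succ, ih, ← zpow_add₀ hb, ← zpow_add₀ hb]
      congr 1
      push_cast
      ring
  rw [pgfDet, hentry, Matrix.det_mul_column, Matrix.det_mul_row, ← mul_assoc, hprod, pgfDet]

theorem ppoly_mul_mul {R : Type*} [CommRing R] (b x y : R) (m k : ℕ) :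
    ppoly (b * x) (b * y) m k = b ^ m * ppoly x y m k := by
  have hterm (s : ℕ) (hs : s ∈ Finset.range (m / k + 1)) :
      b ^ m = b ^ (s * k) * b ^ (m - s * k) := by
    rw [← pow_add, Nat.add_sub_of_le]
    exact (Nat.mul_le_mul_right k (Finset.mem_range_succ_iff.1 hs)).trans (Nat.div_mul_le_self m k)
  unfold ppoly
  split_ifs
  all_goals
    rw [Finset.mul_sum]
    refine Finset.sum_congr rfl fun s hs => ?_
    rw [hterm s hs]
    ring

/-- An evaluation of `pgfDet` on the real hyperbola `u * v = 1` extends to every commutative ring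
by homogeneity. -/
theorem pgfDet_eq_of_real {R : Type*} [CommRing R] (x y : R) (n : ℕ) (k : ℤ) (c : ℤ)
    (e m d : ℕ) (hdeg : c ≠ 0 → (n : ℤ) * (n - k) = 2 * e + m)
    (h : ∀ u v : ℝ, u * v = 1 → pgfDet u v n k = c * ppoly u v m d) :
    pgfDet x y n k = c * (x * y) ^ e * ppoly x y m d := by
  have key : pgfDet (MvPolynomial.X 0 : MvPolynomial (Fin 2) ℤ) (MvPolynomial.X 1) n k =
      (c : MvPolynomial (Fin 2) ℤ) * (MvPolynomial.X 0 * MvPolynomial.X 1) ^ e *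
        ppoly (MvPolynomial.X 0) (MvPolynomial.X 1) m d := by
    apply MvPolynomial.map_injective (Int.castRingHom ℝ) Int.cast_injective
    refine MvPolynomial.funext_set (fun _ => Set.Ioi 0) (fun _ => Set.Ioi_infinite 0)
      fun z hz => ?_
    have h₀ : 0 < z 0 := hz 0 (Set.mem_univ _)
    have h₁ : 0 < z 1 := hz 1 (Set.mem_univ _)
    simp only [map_pgfDet, map_mul, map_pow, map_ppoly, MvPolynomial.map_X, MvPolynomial.eval_X,
      map_intCast]
    have hs₀ := Real.sqrt_pos.2 h₀
    have hs₁ := Real.sqrt_pos.2 h₁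
    obtain ⟨b, w, hb, hw, hz₀, hz₁⟩ : ∃ b w : ℝ, b ≠ 0 ∧ w ≠ 0 ∧ z 0 = b * w ∧ z 1 = b * w⁻¹ := by
      refine ⟨√(z 0) * √(z 1), √(z 0) / √(z 1), by positivity, by positivity, ?_, ?_⟩
      · field_simp
        exact (Real.sq_sqrt h₀.le).symm
      · field_simp
        exact (Real.sq_sqrt h₁.le).symm
    rw [hz₀, hz₁, pgfDet_mul_mul b _ _ hb, ppoly_mul_mul, h _ _ (mul_inv_cancel₀ hw)]
    rcases eq_or_ne c 0 with rfl | hc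
    · simp
    rw [hdeg hc, zpow_add₀ hb, zpow_natCast, zpow_mul, zpow_natCast,
      show b * w * (b * w⁻¹) = b ^ 2 by field_simp]
    norm_cast
    ring
  let f : MvPolynomial (Fin 2) ℤ →+* R := MvPolynomial.eval₂Hom (Int.castRingHom R) ![x, y]
  have hx : f (MvPolynomial.X 0) = x := MvPolynomial.eval₂Hom_X' _ _ _
  have hy : f (MvPolynomial.X 1) = y := MvPolynomial.eval₂Hom_X' _ _ _
  simpa only [map_pgfDet, map_mul, map_pow, map_ppoly, map_intCast, hx, hy] using congrArg f key

theorem pgfDet_two_mul {R : Type*} [CommRing R] (x y : R) (k N n : ℕ) (hk : 0 < k)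
    (hn : n = 2 * k * N) :
    pgfDet x y n k = (-1) ^ (k * N) * (x * y) ^ (k * N * (2 * k * N - k - 1)) * ppoly x y n k := by
  have := pgfDet_eq_of_real x y n k ((-1) ^ (k * N)) (k * N * (2 * k * N - k - 1)) n k ?_
    fun u v huv => by
      push_cast
      exact pgfDet_mod_zero u v huv k N n hk hn
  · simpa using this
  · intro _
    obtain ⟨l, rfl⟩ := Nat.exists_eq_add_of_le' hk
    rcases N with _ | N
    · simp [hn]
    have h : 2 * (l + 1) * (N + 1) - (l + 1) - 1 = 2 * (l + 1) * N + l := by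
      rw [mul_add _ N 1]
      lia
    rw [h, hn]
    push_cast
    ring

theorem pgfDet_two_mul_sub {R : Type*} [CommRing R] (x y : R) (k N n : ℕ) (hk : 0 < k)
    (hn : n + k = 2 * k * (N + 1)) :
    pgfDet x y n k = (-1) ^ (k * (N + 1) + (k + 1).choose 2) *
      (x * y) ^ (k * (N + 1 - 1) * (2 * k * (N + 1) - k - 1)) * ppoly x y (n - k) k := by
  have hn' : n = 2 * k * N + k := by
    rw [mul_add] at hn
    lia
  have := pgfDet_eq_of_real x y n k ((-1) ^ (k * (N + 1) + (k + 1).choose 2))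
    (k * (N + 1 - 1) * (2 * k * (N + 1) - k - 1)) (n - k) k ?_
    fun u v huv => by
      push_cast
      rw [show n - k = 2 * k * N by lia]
      exact pgfDet_mod_self u v huv k N n hk hn'
  · simpa using this
  · intro _
    obtain ⟨l, rfl⟩ := Nat.exists_eq_add_of_le' hk
    have h : 2 * (l + 1) * (N + 1) - (l + 1) - 1 = 2 * (l + 1) * N + l := by
      rw [mul_add _ N 1]
      lia
    rw [h, hn', Nat.add_sub_cancel, Nat.add_sub_cancel]
    push_cast
    ring

theorem pgfDet_two_mul_sub_add_one {R : Type*} [CommRing R] (x y : R) (k N n : ℕ) (hk : 2 ≤ k)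
    (hn : n + k = 2 * k * (N + 1) + 1) :
    pgfDet x y n k = (-1) ^ (k * (N + 1) + k.choose 2) *
      (x * y) ^ (k * (N + 1 - 1) * (2 * k * (N + 1) - k + 1)) * ppoly x y n k := by
  have hn' : n = 2 * k * N + (k + 1) := by
    rw [mul_add] at hn
    lia
  have := pgfDet_eq_of_real x y n k ((-1) ^ (k * (N + 1) + k.choose 2))
    (k * (N + 1 - 1) * (2 * k * (N + 1) - k + 1)) n k ?_
    fun u v huv => by
      push_cast
      rw [show k * (N + 1) + k.choose 2 = k * N + (k + 1).choose 2 by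
        rw [Nat.choose_succ_succ' k 1, Nat.choose_one_right]
        ring]
      exact pgfDet_mod_succ u v huv k N n hk hn'
  · simpa using this
  · intro _
    have h : 2 * k * (N + 1) - k + 1 = 2 * k * N + k + 1 := by
      rw [mul_add _ N 1]
      lia
    rw [h, hn', Nat.add_sub_cancel]
    push_cast
    ring

theorem pgfDet_two_mul_sub_one {R : Type*} [CommRing R] (x y : R) (k N n : ℕ) (hk : 2 ≤ k)
    (hn : n + 1 = 2 * k * (N + 1)) :
    pgfDet x y n k = (-1) ^ (k * (N + 1 - 1) + 1) *
      (x * y) ^ (k * (N + 1 : ℕ) * (2 * k * (N + 1 : ℕ) - k - 3) + k : ℤ).toNat *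
      ppoly x y (n - k + 2) k := by
  have hn' : n - k + 2 = 2 * k * N + (k + 1) := by
    rw [mul_add] at hn
    lia
  have := pgfDet_eq_of_real x y n k ((-1) ^ (k * (N + 1 - 1) + 1))
    (k * (N + 1 : ℕ) * (2 * k * (N + 1 : ℕ) - k - 3) + k : ℤ).toNat (n - k + 2) k ?_
    fun u v huv => by
      push_cast
      rw [hn']
      exact pgfDet_mod_neg_one u v huv k N n hk hn
  · simpa using this
  · intro _
    obtain ⟨l, rfl⟩ := Nat.exists_eq_add_of_le' hk
    have h : (((l + 2 : ℕ) : ℤ) * (N + 1 : ℕ) * (2 * (l + 2 : ℕ) * (N + 1 : ℕ) - (l + 2 : ℕ) - 3) +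
        (l + 2 : ℕ)) =
        (((l + 2) * (2 * l * N ^ 2 + 4 * N ^ 2 + 3 * l * N + 3 * N + l) : ℕ) : ℤ) := by
      push_cast
      ring
    have hnz : (n : ℤ) = 2 * (l + 2) * (N + 1) - 1 := by
      rw [eq_sub_iff_add_eq]
      exact_mod_cast hn
    rw [h, Int.toNat_natCast, hn', hnz]
    push_cast
    ring

theorem ppoly_one {R : Type*} [CommRing R] (x y : R) (m : ℕ) :
    ppoly x y m 1 = ∑ s ∈ Finset.range (m + 1), (-1 : R) ^ s * x ^ s * y ^ (m - s) := by
  simp [ppoly, mul_assoc]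

theorem ppoly_of_lt {R : Type*} [CommRing R] (x y : R) (m k : ℕ) (hm : 0 < m) (hk : m < k) :
    ppoly x y m k = y ^ m + x ^ m := by
  rw [ppoly, if_neg (Nat.not_dvd_of_pos_of_lt hm hk), Nat.div_eq_of_lt hk]
  simp

theorem mul_self_eq_two_mul_choose_add (n : ℕ) : n * n = 2 * n.choose 2 + n := by
  rw [Nat.choose_two_right, Nat.mul_div_cancel' (Nat.even_mul_pred_self n).two_dvd]
  rcases n with _ | n
  · rfl
  · simp only [Nat.add_sub_cancel]
    ring

/-- Theorem 4: evaluation of `det_{0≤i,j≤n−1}(P_{i+j+1}(0,k))`.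
Hypotheses like `n = 2kn₁−1` are stated additively (`n + 1 = 2kn₁`) to avoid truncated
subtraction; the sign `(−1)^{k(n₁−1)−1}` is written as `(−1)^{k(n₁−1)+1}` (same parity),
and the exponent `kn₁(2kn₁−k−3)+k` (which is a nonnegative integer but whose
subexpression `2kn₁−k−3` may be negative) is computed in `ℤ` and converted by `toNat`. -/
theorem det_hankel_pgf_one {R : Type*} [CommRing R] (x y : R) (n : ℕ) (hn : 0 < n) :
    (∀ k : ℕ, 2 ≤ k →
      (∀ n₁ : ℕ, 0 < n₁ → n + 1 = 2 * k * n₁ →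
        Matrix.det (Matrix.of fun i j : Fin n => pgf x y (i.1 + j.1 + 1) (k : ℤ)) =
          (-1 : R) ^ (k * (n₁ - 1) + 1) *
            (x * y) ^ ((k * n₁ * (2 * k * n₁ - k - 3) + k : ℤ)).toNat *
            ppoly x y (n - k + 2) k) ∧
      (∀ n₁ : ℕ, 0 < n₁ → n + k = 2 * k * n₁ + 1 →
        Matrix.det (Matrix.of fun i j : Fin n => pgf x y (i.1 + j.1 + 1) (k : ℤ)) =
          (-1 : R) ^ (k * n₁ + Nat.choose k 2) *
            (x * y) ^ (k * (n₁ - 1) * (2 * k * n₁ - k + 1)) * ppoly x y n k) ∧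
      (∀ n₁ : ℕ, 0 < n₁ → n + k = 2 * k * n₁ →
        Matrix.det (Matrix.of fun i j : Fin n => pgf x y (i.1 + j.1 + 1) (k : ℤ)) =
          (-1 : R) ^ (k * n₁ + Nat.choose (k + 1) 2) *
            (x * y) ^ (k * (n₁ - 1) * (2 * k * n₁ - k - 1)) * ppoly x y (n - k) k) ∧
      (∀ n₁ : ℕ, 0 < n₁ → n = 2 * k * n₁ →
        Matrix.det (Matrix.of fun i j : Fin n => pgf x y (i.1 + j.1 + 1) (k : ℤ)) =
          (-1 : R) ^ (k * n₁) *
            (x * y) ^ (k * n₁ * (2 * k * n₁ - k - 1)) * ppoly x y n k) ∧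
      (n % (2 * k) ≠ 0 ∧ n % (2 * k) ≠ k ∧ n % (2 * k) ≠ k + 1 ∧ n % (2 * k) ≠ 2 * k - 1 →
        Matrix.det (Matrix.of fun i j : Fin n => pgf x y (i.1 + j.1 + 1) (k : ℤ)) = 0)) ∧
    ((∀ n₁ : ℕ, 0 < n₁ → n = 2 * n₁ →
        Matrix.det (Matrix.of fun i j : Fin n => pgf x y (i.1 + j.1 + 1) (1 : ℤ)) =
          (-1 : R) ^ n₁ * (x * y) ^ (2 * n₁ * (n₁ - 1)) *
            ∑ s ∈ Finset.range (n + 1), (-1 : R) ^ s * x ^ s * y ^ (n - s)) ∧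
      (∀ n₁ : ℕ, 0 < n₁ → n + 1 = 2 * n₁ →
        Matrix.det (Matrix.of fun i j : Fin n => pgf x y (i.1 + j.1 + 1) (1 : ℤ)) =
          (-1 : R) ^ (n₁ + 1) * (x * y) ^ (2 * (n₁ - 1) ^ 2) *
            ∑ s ∈ Finset.range n, (-1 : R) ^ s * x ^ s * y ^ (n - 1 - s))) ∧
    Matrix.det (Matrix.of fun i j : Fin n => pgf x y (i.1 + j.1 + 1) (0 : ℤ)) =
      2 ^ (n - 1) * (x * y) ^ Nat.choose n 2 * (x ^ n + y ^ n) := by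
  refine ⟨fun k hk => ⟨fun n₁ h₁ h => ?_, fun n₁ h₁ h => ?_, fun n₁ h₁ h => ?_,
    fun n₁ h₁ h => pgfDet_two_mul x y k n₁ n (by lia) h, fun h => ?_⟩,
    ⟨fun n₁ h₁ h => ?_, fun n₁ h₁ h => ?_⟩, ?_⟩
  · obtain ⟨N, rfl⟩ := Nat.exists_eq_add_of_le' h₁
    exact pgfDet_two_mul_sub_one x y k N n hk h
  · obtain ⟨N, rfl⟩ := Nat.exists_eq_add_of_le' h₁
    exact pgfDet_two_mul_sub_add_one x y k N n hk h
  · obtain ⟨N, rfl⟩ := Nat.exists_eq_add_of_le' h₁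
    exact pgfDet_two_mul_sub x y k N n (by lia) h
  · have := pgfDet_eq_of_real x y n k 0 0 0 k (by simp) fun u v huv => by
      simpa using pgfDet_eq_zero_of_mul_eq_one u v huv k n hk h.1 h.2.1 h.2.2.1 h.2.2.2
    simpa [pgfDet] using this
  · have := pgfDet_two_mul x y 1 n₁ n one_pos (by lia)
    rw [ppoly_one, Nat.cast_one, pgfDet] at this
    rw [this, one_mul, show n₁ * (2 * 1 * n₁ - 1 - 1) = 2 * n₁ * (n₁ - 1) by
      rw [mul_comm 2 n₁, mul_assoc]
      congr 1
      lia]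
  · obtain ⟨N, rfl⟩ := Nat.exists_eq_add_of_le' h₁
    have := pgfDet_two_mul_sub x y 1 N n one_pos (by lia)
    rw [ppoly_one, Nat.cast_one, pgfDet, Nat.sub_add_cancel hn] at this
    rw [this, one_mul, Nat.choose_self, show 1 * (N + 1 - 1) * (2 * 1 * (N + 1) - 1 - 1) =
      2 * (N + 1 - 1) ^ 2 by
        rw [show 2 * 1 * (N + 1) - 1 - 1 = 2 * N by lia, Nat.add_sub_cancel]
        ring]
  · have := pgfDet_eq_of_real x y n 0 (2 ^ (n - 1)) (n.choose 2) n (n + 1)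
      (fun _ => by
        rw [sub_zero]
        exact_mod_cast mul_self_eq_two_mul_choose_add n)
      fun u v huv => by
        rw [ppoly_of_lt _ _ _ _ hn n.lt_succ_self, pgfDet, det_pgf_zero_of_mul_eq_one u v huv n hn]
        push_cast
        ring
    rw [ppoly_of_lt _ _ _ _ hn n.lt_succ_self, pgfDet] at this
    rw [this]
    push_cast
    ring
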